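/- Let L : ℝ^d → ℝ^𝒴 be a polyhedral loss and p ∈ Δ_𝒴, and let U = argmin_{u∈ℝ^d} ⟨p, L(u)⟩. Then U is nonempty, and there exists a constant c > 0 such that for all u ∈ ℝ^d: ⟨p, L(u)⟩ − inf_{u'∈ℝ^d} ⟨p, L(u')⟩ ≥ c · dist(u, U), where dist denotes Euclidean distance to the set U. -/

import Mathlib

/-- The probability simplex over a finite outcome set `Y`. -/
def probSimplex (Y : Type*) [Fintype Y] : Set (Y → ℝ) :=
  {p | (∀ y, 0 ≤ p y) ∧ ∑ y, p y = 1}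

/-- Expected loss `⟨p, v⟩ = ∑ y, p y * v y`. -/
def elloss {Y : Type*} [Fintype Y] (p : Y → ℝ) (v : Y → ℝ) : ℝ :=
  ∑ y, p y * v y

/-- `u` minimizes the expected loss `⟨p, L ·⟩` over the report set. -/
def Minimizes {U Y : Type*} [Fintype Y] (p : Y → ℝ) (L : U → Y → ℝ) (u : U) : Prop :=
  ∀ u' : U, elloss p (L u) ≤ elloss p (L u')

/-- A polyhedral convex function on Euclidean space: a pointwise maximum of finitely many
affine functions. -/
def IsPolyhedralFnE {d : ℕ} (g : EuclideanSpace ℝ (Fin d) → ℝ) : Prop :=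
  ∃ (m : ℕ) (a : Fin (m + 1) → EuclideanSpace ℝ (Fin d)) (b : Fin (m + 1) → ℝ),
    ∀ x, g x = Finset.univ.sup' Finset.univ_nonempty (fun i => ∑ j, a i j * x j + b i)

open Filter Topology in
/-- A uniform descent direction for a finite set of slopes whose hull misses the origin. -/
theorem aux_direction {E : Type*} [NormedAddCommGroup E] [InnerProductSpace ℝ E]
    [FiniteDimensional ℝ E] (S : Set E) (hS : S.Finite) :
    ∃ c : ℝ, 0 < c ∧ ((0 : E) ∈ convexHull ℝ S ∨
      ∃ v : E, ‖v‖ ≤ 1 ∧ ∀ a ∈ S, inner ℝ a v ≤ -c) := by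
  by_cases h0 : (0 : E) ∈ convexHull ℝ S
  · exact ⟨1, one_pos, Or.inl h0⟩
  · obtain ⟨f, u, hu, hf⟩ := geometric_hahn_banach_point_closed (convex_convexHull ℝ S)
      (hS.isCompact_convexHull ℝ).isClosed h0
    rw [map_zero] at hu
    have : CompleteSpace E := FiniteDimensional.complete ℝ E
    set w := (InnerProductSpace.toDual ℝ E).symm f with hw
    have hfw : ∀ a, inner ℝ a w = f a := by
      intro a
      rw [real_inner_comm, hw, InnerProductSpace.toDual_symm_apply]
    have hn : 0 < ‖w‖ + 1 := by positivity
    refine ⟨u / (‖w‖ + 1), by positivity, Or.inr ⟨-((‖w‖ + 1)⁻¹ • w), ?_, ?_⟩⟩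
    · rw [norm_neg, norm_smul, norm_inv, Real.norm_of_nonneg hn.le, inv_mul_le_iff₀ hn]
      linarith
    · intro a ha
      rw [inner_neg_right, inner_smul_right, hfw, neg_le_neg_iff, div_eq_inv_mul]
      have := hf a (subset_convexHull ℝ S ha)
      gcongr

open Filter Topology in
/-- Weak sharp minima for a nonnegative maximum of finitely many affine functions. -/
theorem aux_sharp {E : Type*} [NormedAddCommGroup E] [InnerProductSpace ℝ E]
    [FiniteDimensional ℝ E] {ι : Type*} [Finite ι] (f : E → ℝ) (hc : Continuous f)
    (h0 : ∀ x, 0 ≤ f x) (a : ι → E) (b : ι → ℝ)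
    (hle : ∀ x i, inner ℝ (a i) x + b i ≤ f x)
    (hex : ∀ x, ∃ i, f x = inner ℝ (a i) x + b i) :
    ∃ c : ℝ, 0 < c ∧ ∀ x, ∃ z, (∀ w, f z ≤ f w) ∧ f z + c * ‖z - x‖ ≤ f x := by
  choose C hC0 hC using fun I : Set ι => aux_direction (a '' I) (I.toFinite.image a)
  obtain ⟨I₀, hI₀⟩ := Finite.exists_min C
  set c := C I₀ with hcdef
  have hcpos : 0 < c := hC0 I₀
  refine ⟨c / 2, by positivity, fun x => ?_⟩
  have hcont : Continuous (fun z => f z + c / 2 * ‖z - x‖) := by fun_prop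
  have htend : Tendsto (fun z => f z + c / 2 * ‖z - x‖) (cocompact E) atTop := by
    have h1 : Tendsto (fun z : E => c / 2 * (‖z‖ - ‖x‖)) (cocompact E) atTop :=
      (tendsto_atTop_add_const_right _ _ (tendsto_norm_cocompact_atTop (E := E))).const_mul_atTop
        (by positivity)
    refine tendsto_atTop_mono (fun z => ?_) h1
    have h2 := norm_sub_norm_le z x
    have h3 := h0 z
    have : c / 2 * (‖z‖ - ‖x‖) ≤ c / 2 * ‖z - x‖ := by gcongr
    linarith
  obtain ⟨z, hz⟩ := hcont.exists_forall_le htend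
  refine ⟨z, ?_, by simpa using hz x⟩
  rcases hC {i | f z = inner ℝ (a i) z + b i} with h | ⟨v, hv, hav⟩
  · intro w
    have hconv : Convex ℝ {q : E | inner ℝ (w - z) q ≤ f w - f z} :=
      convex_halfSpace_le (f := fun q : E => inner ℝ (w - z) q)
        (innerSL ℝ (w - z)).toLinearMap.isLinear _
    have hsub : a '' {i | f z = inner ℝ (a i) z + b i} ⊆
        {q : E | inner ℝ (w - z) q ≤ f w - f z} := by
      rintro _ ⟨i, hi, rfl⟩
      simp only [Set.mem_ofPred_eq] at hi ⊢
      rw [real_inner_comm, inner_sub_right]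
      have := hle w i
      linarith
    have := convexHull_min hsub hconv h
    simp only [Set.mem_ofPred_eq, inner_zero_right] at this
    linarith
  · exfalso
    have hcI := hI₀ {i | f z = inner ℝ (a i) z + b i}
    have hev : ∀ᶠ t : ℝ in 𝓝[>] 0, ∀ i, inner ℝ (a i) (z + t • v) + b i ≤ f z - c * t := by
      rw [eventually_all]
      intro i
      by_cases hi : f z = inner ℝ (a i) z + b i
      · filter_upwards [self_mem_nhdsWithin] with t ht
        have ht' : 0 < t := ht
        have h1 : inner ℝ (a i) v ≤ -c := (hav (a i) ⟨i, hi, rfl⟩).trans (by linarith)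
        rw [inner_add_right, inner_smul_right]
        nlinarith
      · have hlt : inner ℝ (a i) z + b i < f z := lt_of_le_of_ne (hle z i) (Ne.symm hi)
        have hcn : Continuous fun t : ℝ =>
            inner ℝ (a i) (z + t • v) + b i - (f z - c * t) := by fun_prop
        have h2 := hcn.continuousAt (x := 0)
        have h3 : ∀ᶠ t in 𝓝 (0 : ℝ), inner ℝ (a i) (z + t • v) + b i - (f z - c * t) < 0 :=
          h2.eventually_lt_const (by simpa using by linarith)
        filter_upwards [nhdsWithin_le_nhds h3] with t ht
        linarith
    obtain ⟨t, ht, htpos⟩ := (hev.and self_mem_nhdsWithin).exists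
    have htpos' : 0 < t := htpos
    obtain ⟨i, hi⟩ := hex (z + t • v)
    have h1 := ht i
    have h2 := hz (z + t • v)
    have h3 : ‖z + t • v - x‖ ≤ ‖z - x‖ + t := by
      have e : z + t • v - x = (z - x) + t • v := by abel
      rw [e]
      refine (norm_add_le _ _).trans ?_
      rw [norm_smul, Real.norm_of_nonneg htpos'.le]
      nlinarith
    have h4 : c / 2 * ‖z + t • v - x‖ ≤ c / 2 * (‖z - x‖ + t) := by gcongr
    nlinarith [mul_pos hcpos htpos']

/-- For a polyhedral loss `L` and `p` in the simplex, the set `U` of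
minimizers of `⟨p, L ·⟩` is nonempty, and the excess expected loss at `u` is at least
`c · dist(u, U)` for some constant `c > 0` (Euclidean distance). -/
theorem polyhedral_loss_excess_risk_ge_dist
    {Y : Type*} [Fintype Y] {d : ℕ}
    (L : EuclideanSpace ℝ (Fin d) → Y → ℝ) (hL0 : ∀ u y, 0 ≤ L u y)
    (hpoly : ∀ y, IsPolyhedralFnE (fun u => L u y))
    (p : Y → ℝ) (hp : p ∈ probSimplex Y) :
    ({u | Minimizes p L u}).Nonempty ∧
    ∃ c > 0, ∀ u : EuclideanSpace ℝ (Fin d),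
      c * Metric.infDist u {u' | Minimizes p L u'} ≤
        elloss p (L u) - sInf (Set.range fun u' => elloss p (L u')) := by
  choose m a b hab using hpoly
  obtain ⟨hp0, -⟩ := hp
  have hLc : ∀ y, Continuous fun u => L u y := by
    intro y
    have : (fun u => L u y) = fun x => Finset.univ.sup' Finset.univ_nonempty
        (fun i => ∑ j, a y i j * x j + b y i) := funext (hab y)
    rw [this]
    refine Continuous.finset_sup'_apply _ fun i _ => ?_
    fun_prop
  have hin : ∀ (s : ∀ y, Fin (m y + 1)) (x : EuclideanSpace ℝ (Fin d)),
      inner ℝ (∑ y, p y • a y (s y)) x + ∑ y, p y * b y (s y)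
        = ∑ y, p y * (∑ j, a y (s y) j * x j + b y (s y)) := by
    intro s x
    rw [sum_inner, ← Finset.sum_add_distrib]
    refine Finset.sum_congr rfl fun y _ => ?_
    rw [real_inner_smul_left, mul_add, PiLp.inner_apply]
    simp [mul_comm]
  obtain ⟨c, hc, hmain⟩ := aux_sharp (ι := ∀ y, Fin (m y + 1)) (fun u => elloss p (L u))
    (by unfold elloss; fun_prop)
    (fun x => Finset.sum_nonneg fun y _ => mul_nonneg (hp0 y) (hL0 x y))
    (fun s => ∑ y, p y • a y (s y)) (fun s => ∑ y, p y * b y (s y))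
    (by
      intro x s
      rw [hin]
      refine Finset.sum_le_sum fun y _ => mul_le_mul_of_nonneg_left ?_ (hp0 y)
      have := hab y x
      simp only at this
      rw [this]
      exact Finset.le_sup' (fun i => ∑ j, a y i j * x j + b y i) (Finset.mem_univ (s y)))
    (by
      intro x
      have : ∀ y, ∃ i, L x y = ∑ j, a y i j * x j + b y i := by
        intro y
        obtain ⟨i, -, hi⟩ := Finset.exists_mem_eq_sup' Finset.univ_nonempty
          (fun i => ∑ j, a y i j * x j + b y i)
        exact ⟨i, (hab y x).trans hi⟩
      choose s hs using this
      refine ⟨s, ?_⟩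
      rw [hin]
      exact Finset.sum_congr rfl fun y _ => by rw [hs y])
  refine ⟨?_, c, hc, fun u => ?_⟩
  · obtain ⟨z, hz, -⟩ := hmain 0
    exact ⟨z, hz⟩
  · obtain ⟨z, hz, hzu⟩ := hmain u
    have hinf : sInf (Set.range fun u' => elloss p (L u')) = elloss p (L z) := by
      apply IsLeast.csInf_eq
      exact ⟨⟨z, rfl⟩, by rintro _ ⟨w, rfl⟩; exact hz w⟩
    have hd : Metric.infDist u {u' | Minimizes p L u'} ≤ dist u z :=
      Metric.infDist_le_dist_of_mem hz
    rw [dist_comm, dist_eq_norm] at hd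
    have := mul_le_mul_of_nonneg_left hd hc.le
    rw [hinf]
    linarith
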